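/- Let T be a k-linear Hom-finite Krull-Schmidt triangulated category with Serre functor ν, d ≥ 1, and P a d-silting subcategory which is ν_d-non-degenerate and admits an adjacent t-structure. Then U_d(P) := add{ν_d^i(P) : i ∈ ℤ} is a d-cluster tilting subcategory of T (at least in the weak sense: an object X belongs to U_d(P) if and only if Hom_T(U_d(P), X[i]) = 0 for all 1 ≤ i ≤ d−1). -/

import Mathlib

/-!
STATEMENT 8: If P is a ν_d-non-degenerate d-silting subcategory of a k-linear
Hom-finite Krull-Schmidt triangulated category T with Serre functor ν, admitting
an adjacent t-structure, then U_d(P) = add{ν_d^i(P)} is d-cluster tilting in the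
weak sense: X ∈ U_d(P) iff Hom(U_d(P), X[i]) = 0 for all 1 ≤ i ≤ d-1.
-/

open CategoryTheory CategoryTheory.Limits CategoryTheory.Pretriangulated

universe w v u

variable (k : Type w) [Field k]
variable (C : Type u) [Category.{v} C] [Preadditive C] [Linear k C] [HasZeroObject C]
  [HasShift C ℤ] [∀ n : ℤ, (CategoryTheory.shiftFunctor C n).Additive] [Pretriangulated C]
  [HasBinaryBiproducts C]

/-- A Serre functor on a k-linear category: an (additive) autoequivalence ν together
with functorial isomorphisms D Hom(X,Y) ≅ Hom(Y, νX). -/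
structure SerreFunctor : Type (max (max u v) w) where
  ν : C ≌ C
  additive : ν.functor.Additive
  duality : ∀ X Y : C, (Y ⟶ ν.functor.obj X) ≃ₗ[k] Module.Dual k (X ⟶ Y)
  natural : ∀ (X Y X' Y' : C) (a : X ⟶ X') (b : Y' ⟶ Y) (f : Y ⟶ ν.functor.obj X),
    duality X' Y' (b ≫ f ≫ ν.functor.map a) = fun g => duality X Y f (a ≫ g ≫ b)

variable {k C}

/-- ν_d = ν ∘ [-d]. -/
def nud (S : SerreFunctor k C) (d : ℕ) : C ⥤ C :=
  CategoryTheory.shiftFunctor C (-(d : ℤ)) ⋙ S.ν.functor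

/-- The inverse of ν_d. -/
def nudInv (S : SerreFunctor k C) (d : ℕ) : C ⥤ C :=
  S.ν.inverse ⋙ CategoryTheory.shiftFunctor C (d : ℤ)


/-- Iteration of an endofunctor. -/
def iterObj (F : C ⥤ C) : ℕ → C → C
  | 0, X => X
  | n + 1, X => F.obj (iterObj F n X)

/-- A thick subcategory: closed under isomorphisms, shifts, extensions and
direct summands. -/
structure IsThick (Z : Set C) : Prop where
  iso : ∀ {X Y : C}, (X ≅ Y) → X ∈ Z → Y ∈ Z
  shift : ∀ X ∈ Z, ∀ n : ℤ, X⟦n⟧ ∈ Z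
  ext₂ : ∀ T ∈ distTriang C, T.obj₁ ∈ Z → T.obj₃ ∈ Z → T.obj₂ ∈ Z
  summand : ∀ X Y : C, [HasBinaryBiproduct X Y] → (X ⊞ Y) ∈ Z → X ∈ Z

/-- `S` generates `C` as a thick subcategory: `thick S = C`. -/
def GeneratesThick (S : Set C) : Prop :=
  ∀ Z : Set C, IsThick Z → S ⊆ Z → ∀ X : C, X ∈ Z

/-- A presilting subcategory: Hom(P, P[i]) = 0 for all i ≥ 1. -/
def IsPresiltingSet (P : Set C) : Prop :=
  ∀ A ∈ P, ∀ B ∈ P, ∀ i : ℤ, 1 ≤ i → ∀ f : A ⟶ B⟦i⟧, f = 0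

/-- A silting subcategory: presilting and generating C as a thick subcategory. -/
def IsSiltingSet (P : Set C) : Prop := IsPresiltingSet P ∧ GeneratesThick P

/-- The coaisle T_{≥0}^P = ^⊥(P[>0]) of the co-t-structure associated to P. -/
def coAisleGE (P : Set C) : Set C :=
  {X | ∀ A ∈ P, ∀ i : ℤ, 1 ≤ i → ∀ f : X ⟶ A⟦i⟧, f = 0}

/-- The aisle T_{≤0}^P = (P[<0])^⊥ of the co-t-structure associated to P. -/
def coAisleLE (P : Set C) : Set C :=
  {X | ∀ A ∈ P, ∀ i : ℤ, 1 ≤ i → ∀ f : A⟦-i⟧ ⟶ X, f = 0}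


/-- Objects obtained as finite direct sums of objects of `S`. -/
inductive sums (S : Set C) : C → Prop
  | of {X : C} : X ∈ S → sums S X
  | biprod {X Y : C} : sums S X → sums S Y → sums S (X ⊞ Y)

/-- The additive closure `add S`. -/
def addSet (S : Set C) : Set C :=
  {X | ∃ Y Z : C, sums S Y ∧ Nonempty (Y ≅ X ⊞ Z)}

/-- The ν_d-orbit of an object (closed under isomorphism). -/
def nudOrbit (S : SerreFunctor k C) (d : ℕ) (X : C) : Set C :=
  {Y | ∃ n : ℕ, Nonempty (Y ≅ iterObj (nud S d) n X) ∨
    Nonempty (Y ≅ iterObj (nudInv S d) n X)}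

/-- U_d(P) = add { ν_d^i(A) : i ∈ ℤ, A ∈ P }. -/
def UdSet (S : SerreFunctor k C) (d : ℕ) (P : Set C) : Set C :=
  addSet (⋃ A ∈ P, nudOrbit S d A)


/-- The t-structure adjacent to the co-t-structure of a silting subcategory `P`:
a pair with aisle `T_{≤0}^P` and coaisle `B = T^{≥1}_P`. -/
structure AdjacentTStructure (P : Set C) (B : Set C) : Prop where
  shift_aisle : ∀ X ∈ coAisleLE P, X⟦(1:ℤ)⟧ ∈ coAisleLE P
  shift_coaisle : ∀ X ∈ B, X⟦(-1:ℤ)⟧ ∈ B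
  iso_closed : ∀ {X Y : C}, (X ≅ Y) → X ∈ B → Y ∈ B
  orth : ∀ X ∈ coAisleLE P, ∀ Y ∈ B, ∀ f : X ⟶ Y, f = 0
  decomp : ∀ T : C, ∃ A ∈ coAisleLE P, ∃ Y ∈ B,
    ∃ (f : A ⟶ T) (g : T ⟶ Y) (h : Y ⟶ A⟦(1:ℤ)⟧),
      Triangle.mk f g h ∈ distTriang C

/-- `P` is ν_d-non-degenerate:
`⋂_{i ≥ 0} ν_d^{-i}(T_{≤0}^P) = 0` and `⋃_{i ≥ 0} ν_d^{i}(T_{≤0}^P) = T`. -/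
structure NudNonDegenerate (S : SerreFunctor k C) (d : ℕ) (P : Set C) : Prop where
  inter_zero : ∀ X : C, (∀ i : ℕ, iterObj (nud S d) i X ∈ coAisleLE P) → IsZero X
  union_all : ∀ X : C, ∃ i : ℕ, iterObj (nudInv S d) i X ∈ coAisleLE P

set_option linter.unusedSectionVars false

/-- All morphisms `X ⟶ Y` vanish. -/
def HV (X Y : C) : Prop := ∀ f : X ⟶ Y, f = 0


lemma HV.retract_left {X X' Y : C} (h : HV X Y) (r : Retract X' X) : HV X' Y := fun f => by
  have : f = r.i ≫ (r.r ≫ f) := by rw [← Category.assoc, r.retract, Category.id_comp]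
  rw [this, h (r.r ≫ f), comp_zero]

lemma HV.retract_right {X Y Y' : C} (h : HV X Y) (r : Retract Y' Y) : HV X Y' := fun f => by
  have : f = (f ≫ r.i) ≫ r.r := by rw [Category.assoc, r.retract, Category.comp_id]
  rw [this, h (f ≫ r.i), zero_comp]

lemma HV.iso {X Y X' Y' : C} (h : HV X Y) (e : X ≅ X') (e' : Y ≅ Y') : HV X' Y' :=
  (h.retract_left (Retract.ofIso e.symm)).retract_right (Retract.ofIso e'.symm)

lemma HV.iso_iff {X Y X' Y' : C} (e : X ≅ X') (e' : Y ≅ Y') : HV X Y ↔ HV X' Y' :=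
  ⟨fun h => h.iso e e', fun h => h.iso e.symm e'.symm⟩

lemma HV.map_iff (F : C ⥤ C) [F.Full] [F.Faithful] [F.PreservesZeroMorphisms] (X Y : C) :
    HV (F.obj X) (F.obj Y) ↔ HV X Y := by
  constructor
  · intro h f
    apply F.map_injective
    rw [h (F.map f), F.map_zero]
  · intro h f
    obtain ⟨g, rfl⟩ := F.map_surjective f
    rw [h g, F.map_zero]

lemma HV.shift_iff (X Y : C) (a b c : ℤ) (h : c + a = b) :
    HV (X⟦a⟧) (Y⟦b⟧) ↔ HV X (Y⟦c⟧) :=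
  (HV.iso_iff (Iso.refl _) ((shiftFunctorAdd' C c a b h).app Y)).trans
    (HV.map_iff (CategoryTheory.shiftFunctor C a) X (Y⟦c⟧))

lemma HV.shift_left_iff (X Y : C) (a c : ℤ) (h : c + a = 0) :
    HV (X⟦a⟧) Y ↔ HV X (Y⟦c⟧) :=
  (HV.iso_iff (Iso.refl _) ((shiftFunctorZero C ℤ).app Y).symm).trans
    (HV.shift_iff X Y a 0 c h)

lemma HV.shift_zero_left_iff (X Y : C) :
    HV (X⟦(0 : ℤ)⟧) Y ↔ HV X Y :=
  HV.iso_iff ((shiftFunctorZero C ℤ).app X) (Iso.refl _)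

lemma HV.biprod_left {X Y Z : C} (h : HV X Z) (h' : HV Y Z) : HV (X ⊞ Y) Z := fun f => by
  apply biprod.hom_ext'
  · rw [h (biprod.inl ≫ f), comp_zero]
  · rw [h' (biprod.inr ≫ f), comp_zero]

lemma HV.biprod_right_shift {X Y Z : C} (n : ℤ) (h : HV Z (X⟦n⟧)) (h' : HV Z (Y⟦n⟧)) :
    HV Z ((X ⊞ Y)⟦n⟧) := fun f => by
  have e : 𝟙 ((X ⊞ Y)⟦n⟧) = (biprod.fst : X ⊞ Y ⟶ X)⟦n⟧' ≫ (biprod.inl : X ⟶ X ⊞ Y)⟦n⟧' +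
      (biprod.snd : X ⊞ Y ⟶ Y)⟦n⟧' ≫ (biprod.inr : Y ⟶ X ⊞ Y)⟦n⟧' := by
    rw [← Functor.map_comp, ← Functor.map_comp, ← Functor.map_add, biprod.total,
      CategoryTheory.Functor.map_id]
  rw [← Category.comp_id f, e, Preadditive.comp_add, ← Category.assoc, ← Category.assoc,
    h (f ≫ _), h' (f ≫ _), zero_comp, zero_comp, add_zero]

lemma HV.sums_left {P : Set C} {Z : C} (h : ∀ p ∈ P, HV p Z) {X : C} (hX : sums P X) :
    HV X Z := by
  induction hX with
  | of hp => exact h _ hp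
  | biprod _ _ h1 h2 => exact h1.biprod_left h2

lemma HV.sums_right {P : Set C} {Z : C} (n : ℤ) (h : ∀ p ∈ P, HV Z (p⟦n⟧)) {X : C}
    (hX : sums P X) : HV Z (X⟦n⟧) := by
  induction hX with
  | of hp => exact h _ hp
  | biprod _ _ h1 h2 => exact h1.biprod_right_shift n h2

lemma HV.ext_left {Z : C} (T : Triangle C) (hT : T ∈ distTriang C)
    (h1 : HV T.obj₁ Z) (h3 : HV T.obj₃ Z) : HV T.obj₂ Z := fun f => by
  obtain ⟨g, hg⟩ := T.yoneda_exact₂ hT f (h1 _)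
  rw [hg, h3 g, comp_zero]

lemma HV.ext_right {Z : C} (T : Triangle C) (hT : T ∈ distTriang C)
    (h1 : HV Z T.obj₁) (h3 : HV Z T.obj₃) : HV Z T.obj₂ := fun f => by
  obtain ⟨g, hg⟩ := T.coyoneda_exact₂ hT f (h3 _)
  rw [hg, h1 g, zero_comp]

/-- `T_{≤ -n}`: right orthogonal of all `P[i]` with `i < n`. -/
def LL (P : Set C) (n : ℤ) : Set C := {Y | ∀ p ∈ P, ∀ i : ℤ, i < n → HV (p⟦i⟧) Y}

lemma mem_LL_zero_iff (P : Set C) (X : C) : X ∈ coAisleLE P ↔ X ∈ LL P 0 := by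
  constructor
  · intro h p hp i hi
    have := h p hp (-i) (by omega)
    rw [neg_neg] at this
    exact this
  · intro h p hp i hi
    exact h p hp (-i) (by omega)

lemma LL.anti {P : Set C} {m n : ℤ} (h : m ≤ n) {X : C} (hX : X ∈ LL P n) : X ∈ LL P m :=
  fun p hp i hi => hX p hp i (by omega)

lemma LL.retract {P : Set C} {n : ℤ} {X Y : C} (hX : X ∈ LL P n) (r : Retract Y X) :
    Y ∈ LL P n :=
  fun p hp i hi => (hX p hp i hi).retract_right r

lemma LL.shift {P : Set C} {n : ℤ} {X : C} (hX : X ∈ LL P n) (m k : ℤ) (h : n + m = k) :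
    X⟦m⟧ ∈ LL P k := by
  intro p hp i hi
  have h1 := hX p hp (i - m) (by omega)
  rw [HV.shift_left_iff p X (i - m) (m - i) (by omega)] at h1
  exact (HV.shift_iff p X i m (m - i) (by omega)).2 h1

/-- The left orthogonal of `T_{≤ -1}`. -/
def GG (P : Set C) : Set C := {X | ∀ Y ∈ LL P 1, HV X Y}

/-- Objects of `GG P` with a `T_{≤ 0}`-universal morphism to a sum of objects of `P`. -/
def QQ (P : Set C) : Set C := {X | X ∈ GG P ∧ ∃ p : C, sums P p ∧ ∃ e : X ⟶ p,
  ∀ A ∈ LL P 0, ∀ f : X ⟶ A, ∃ g : p ⟶ A, f = e ≫ g}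

lemma GG.ext {P : Set C} (T : Triangle C) (hT : T ∈ distTriang C)
    (h1 : T.obj₁ ∈ GG P) (h3 : T.obj₃ ∈ GG P) : T.obj₂ ∈ GG P :=
  fun Y hY => HV.ext_left T hT (h1 Y hY) (h3 Y hY)

lemma mem_LL_of_presilting {P : Set C} (hP : IsPresiltingSet P) {p : C} (hp : p ∈ P) :
    p ∈ LL P 0 := by
  intro q hq i hi
  rw [HV.shift_left_iff q p i (-i) (by omega)]
  exact hP q hq p hp (-i) (by omega)

lemma sums_mem_LL {P : Set C} (hP : IsPresiltingSet P) {p : C} (hp : sums P p) :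
    p ∈ LL P 0 := by
  intro q hq i hi
  rw [HV.shift_left_iff q p i (-i) (by omega)]
  exact HV.sums_right _ (fun r hr => hP q hq r hr (-i) (by omega)) hp

lemma QQ.ext {P : Set C} (hP : IsPresiltingSet P) (T : Triangle C) (hT : T ∈ distTriang C)
    (h1 : T.obj₁ ∈ QQ P) (h3 : T.obj₃ ∈ QQ P) : T.obj₂ ∈ QQ P := by
  obtain ⟨g1, p1, hp1, e1, he1⟩ := h1
  obtain ⟨g3, p3, hp3, e3, he3⟩ := h3
  refine ⟨GG.ext T hT g1 g3, p1 ⊞ p3, sums.biprod hp1 hp3, ?_⟩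
  have hz : HV T.obj₃ (p1⟦(1 : ℤ)⟧) :=
    g3 _ (LL.shift (sums_mem_LL hP hp1) 1 1 (by omega))
  have hex : ∃ e : T.obj₂ ⟶ p1, e1 = T.mor₁ ≫ e := by
    have hT' := inv_rot_of_distTriang _ hT
    refine Triangle.yoneda_exact₂ _ hT' e1 ?_
    have : HV (T.obj₃⟦(-1 : ℤ)⟧) p1 := (HV.shift_left_iff _ _ (-1) 1 (by omega)).2 hz
    exact this _
  obtain ⟨e, he⟩ := hex
  refine ⟨biprod.lift e (T.mor₂ ≫ e3), ?_⟩
  intro A hA f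
  obtain ⟨a, ha⟩ := he1 A hA (T.mor₁ ≫ f)
  obtain ⟨b, hb⟩ := T.yoneda_exact₂ hT (f - e ≫ a) (by
    rw [Preadditive.comp_sub, ha, he, Category.assoc, sub_self])
  obtain ⟨c, hc⟩ := he3 A hA b
  refine ⟨biprod.desc a c, ?_⟩
  rw [biprod.lift_desc, Category.assoc, ← hc, ← hb]
  abel

/-- Existence of a weight decomposition. -/
def Dec (P : Set C) (B : C) : Prop := ∃ X ∈ QQ P, ∃ Y ∈ LL P 1,
  ∃ (u : X ⟶ B) (v : B ⟶ Y) (w : Y ⟶ X⟦(1 : ℤ)⟧), Triangle.mk u v w ∈ distTriang C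

lemma dt_lift₂ {A B D Q : C} {f : A ⟶ B} {g : B ⟶ D} {h : D ⟶ A⟦(1 : ℤ)⟧}
    (hT : Triangle.mk f g h ∈ distTriang C) (x : Q ⟶ B) (hx : x ≫ g = 0) :
    ∃ y : Q ⟶ A, x = y ≫ f :=
  Triangle.coyoneda_exact₂ _ hT x hx

lemma dt_lift₃ {A B D Q : C} {f : A ⟶ B} {g : B ⟶ D} {h : D ⟶ A⟦(1 : ℤ)⟧}
    (hT : Triangle.mk f g h ∈ distTriang C) (x : Q ⟶ D) (hx : x ≫ h = 0) :
    ∃ y : Q ⟶ B, x = y ≫ g :=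
  Triangle.coyoneda_exact₃ _ hT x hx

lemma dt_lift₁ {A B D Q : C} {f : A ⟶ B} {g : B ⟶ D} {h : D ⟶ A⟦(1 : ℤ)⟧}
    (hT : Triangle.mk f g h ∈ distTriang C) (x : Q ⟶ A⟦(1 : ℤ)⟧) (hx : x ≫ f⟦(1 : ℤ)⟧' = 0) :
    ∃ y : Q ⟶ D, x = y ≫ h :=
  Triangle.coyoneda_exact₁ _ hT x hx

lemma dt_lift_shift {A B D Q : C} {f : A ⟶ B} {g : B ⟶ D} {h : D ⟶ A⟦(1 : ℤ)⟧}
    (hT : Triangle.mk f g h ∈ distTriang C) (x : Q ⟶ B⟦(1 : ℤ)⟧)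
    (hx : x ≫ g⟦(1 : ℤ)⟧' = 0) : ∃ y : Q ⟶ A⟦(1 : ℤ)⟧, x = y ≫ f⟦(1 : ℤ)⟧' := by
  have hs : Triangle.mk (-f⟦(1 : ℤ)⟧') (-g⟦(1 : ℤ)⟧') (-h⟦(1 : ℤ)⟧') ∈ distTriang C :=
    rot_of_distTriang _ (rot_of_distTriang _ (rot_of_distTriang _ hT))
  obtain ⟨y, hy⟩ := dt_lift₂ hs x (by rw [Preadditive.comp_neg, hx, neg_zero])
  exact ⟨-y, by rw [hy, Preadditive.neg_comp, Preadditive.comp_neg]⟩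

lemma dt_zero₁₂ {A B D : C} {f : A ⟶ B} {g : B ⟶ D} {h : D ⟶ A⟦(1 : ℤ)⟧}
    (hT : Triangle.mk f g h ∈ distTriang C) : f ≫ g = 0 := comp_distTriang_mor_zero₁₂ _ hT

lemma dt_zero₂₃ {A B D : C} {f : A ⟶ B} {g : B ⟶ D} {h : D ⟶ A⟦(1 : ℤ)⟧}
    (hT : Triangle.mk f g h ∈ distTriang C) : g ≫ h = 0 := comp_distTriang_mor_zero₂₃ _ hT

lemma dt_zero₃₁ {A B D : C} {f : A ⟶ B} {g : B ⟶ D} {h : D ⟶ A⟦(1 : ℤ)⟧}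
    (hT : Triangle.mk f g h ∈ distTriang C) : h ≫ f⟦(1 : ℤ)⟧' = 0 :=
  comp_distTriang_mor_zero₃₁ _ hT

lemma dt_fill₂ {A B D A' B' D' : C} {f : A ⟶ B} {g : B ⟶ D} {h : D ⟶ A⟦(1 : ℤ)⟧}
    {f' : A' ⟶ B'} {g' : B' ⟶ D'} {h' : D' ⟶ A'⟦(1 : ℤ)⟧}
    (hT : Triangle.mk f g h ∈ distTriang C) (hT' : Triangle.mk f' g' h' ∈ distTriang C)
    (a : A ⟶ A') (c : D ⟶ D') (hc : h ≫ a⟦(1 : ℤ)⟧' = c ≫ h') :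
    ∃ b : B ⟶ B', f ≫ b = a ≫ f' ∧ g ≫ c = b ≫ g' :=
  complete_distinguished_triangle_morphism₂ _ _ hT hT' a c hc

lemma Dec.ext {P : Set C} (hP : IsPresiltingSet P) {A B D : C} {tf : A ⟶ B} {tg : B ⟶ D}
    {th : D ⟶ A⟦(1 : ℤ)⟧} (hT : Triangle.mk tf tg th ∈ distTriang C)
    (h1 : Dec P A) (h3 : Dec P D) : Dec P B := by
  obtain ⟨XA, hXA, YA, hYA, uA, vA, wA, hA⟩ := h1
  obtain ⟨XC, hXC, YC, hYC, uC, vC, wC, hC⟩ := h3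
  have hz : HV XC (YA⟦(1 : ℤ)⟧) :=
    hXC.1 _ (LL.anti (by omega) (LL.shift hYA 1 2 (by omega)))
  obtain ⟨δ, hδ⟩ : ∃ δ : XC ⟶ XA⟦(1 : ℤ)⟧, uC ≫ th = δ ≫ uA⟦(1 : ℤ)⟧' :=
    dt_lift_shift hA _ (hz _)
  obtain ⟨XB, i, p, hX⟩ := distinguished_cocone_triangle₂ δ
  obtain ⟨u, hu1, hu2⟩ := dt_fill₂ hX hT uA uC hδ.symm
  obtain ⟨Y, v, w, hB⟩ := distinguished_cocone_triangle u
  refine ⟨XB, QQ.ext hP _ hX hXA hXC, Y, ?_, u, v, w, hB⟩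
  intro q hq n hn
  generalize hQ : q⟦n⟧ = Q
  have ha : HV Q YA := hQ ▸ hYA q hq n hn
  have hc : HV Q YC := hQ ▸ hYC q hq n hn
  have keyA : ∀ x : Q ⟶ XA⟦(1 : ℤ)⟧, x ≫ uA⟦(1 : ℤ)⟧' = 0 → x = 0 := fun x hx => by
    obtain ⟨y, hy⟩ := dt_lift₁ hA x hx
    rw [hy, ha y, zero_comp]
  have keyC : ∀ x : Q ⟶ XC⟦(1 : ℤ)⟧, x ≫ uC⟦(1 : ℤ)⟧' = 0 → x = 0 := fun x hx => by
    obtain ⟨y, hy⟩ := dt_lift₁ hC x hx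
    rw [hy, hc y, zero_comp]
  have liftA : ∀ x : Q ⟶ A, ∃ y : Q ⟶ XA, x = y ≫ uA := fun x =>
    dt_lift₂ hA x (ha _)
  have liftC : ∀ x : Q ⟶ D, ∃ y : Q ⟶ XC, x = y ≫ uC := fun x =>
    dt_lift₂ hC x (hc _)
  intro f
  have hw : f ≫ w = 0 := by
    have hk : (f ≫ w) ≫ u⟦(1 : ℤ)⟧' = 0 := by
      rw [Category.assoc, dt_zero₃₁ hB, comp_zero]
    generalize f ≫ w = x at hk
    have hx1 : x ≫ p⟦(1 : ℤ)⟧' = 0 := keyC _ (by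
      rw [Category.assoc, ← Functor.map_comp, hu2, Functor.map_comp, ← Category.assoc, hk,
        zero_comp])
    obtain ⟨x', hx'⟩ := dt_lift_shift hX x hx1
    obtain ⟨c, hc'⟩ := dt_lift₁ hT (x' ≫ uA⟦(1 : ℤ)⟧') (by
      rw [Category.assoc, ← Functor.map_comp, ← hu1, Functor.map_comp, ← Category.assoc, ← hx',
        hk])
    obtain ⟨c', rfl⟩ := liftC c
    have h0 : x' - c' ≫ δ = 0 := keyA _ (by
      rw [Preadditive.sub_comp, hc', Category.assoc, Category.assoc, hδ, sub_self])
    rw [hx', sub_eq_zero.1 h0, Category.assoc, dt_zero₃₁ hX, comp_zero]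
  obtain ⟨b, hb⟩ := dt_lift₃ hB f hw
  suffices h : ∃ y : Q ⟶ XB, b = y ≫ u by
    obtain ⟨y, rfl⟩ := h
    rw [hb, Category.assoc, dt_zero₁₂ hB, comp_zero]
  obtain ⟨x, hx⟩ := liftC (b ≫ tg)
  have hx0 : x ≫ δ = 0 := keyA _ (by
    rw [Category.assoc, ← hδ, ← Category.assoc, ← hx, Category.assoc,
      dt_zero₂₃ hT, comp_zero])
  obtain ⟨y, hy⟩ := dt_lift₃ hX x hx0
  obtain ⟨a, ha'⟩ := dt_lift₂ hT (b - y ≫ u) (by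
    rw [Preadditive.sub_comp, hx, hy, Category.assoc, Category.assoc, hu2, sub_self])
  obtain ⟨a', rfl⟩ := liftA a
  refine ⟨y + a' ≫ i, ?_⟩
  rw [Preadditive.add_comp, Category.assoc, hu1, ← Category.assoc, ← ha']
  abel

section

open scoped ZeroObject

lemma dt_iso₂ {A B D B' : C} {f : A ⟶ B} {g : B ⟶ D} {h : D ⟶ A⟦(1 : ℤ)⟧}
    (hT : Triangle.mk f g h ∈ distTriang C) (e : B ≅ B') :
    Triangle.mk (f ≫ e.hom) (e.inv ≫ g) h ∈ distTriang C := by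
  refine isomorphic_distinguished _ hT _ ?_
  refine Triangle.isoMk _ _ (Iso.refl A) e.symm (Iso.refl D) ?_ ?_ ?_
  · change (f ≫ e.hom) ≫ e.inv = 𝟙 A ≫ f
    simp
  · change (e.inv ≫ g) ≫ 𝟙 D = e.inv ≫ g
    simp
  · change h ≫ (𝟙 A)⟦(1 : ℤ)⟧' = 𝟙 D ≫ h
    simp

lemma Dec.iso {P : Set C} {B B' : C} (h : Dec P B) (e : B ≅ B') : Dec P B' := by
  obtain ⟨X, hX, Y, hY, u, v, w, hT⟩ := h
  exact ⟨X, hX, Y, hY, u ≫ e.hom, e.inv ≫ v, w, dt_iso₂ hT e⟩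

lemma Dec.ext' {P : Set C} (hP : IsPresiltingSet P) (T : Triangle C) (hT : T ∈ distTriang C)
    (h1 : Dec P T.obj₁) (h3 : Dec P T.obj₃) : Dec P T.obj₂ :=
  Dec.ext hP (tf := T.mor₁) (tg := T.mor₂) (th := T.mor₃) hT h1 h3

/-- Objects all of whose shifts have weight decompositions. -/
def FF (P : Set C) : Set C := {B | ∀ n : ℤ, Dec P (B⟦n⟧)}

lemma FF.ext {P : Set C} (hP : IsPresiltingSet P) (T : Triangle C) (hT : T ∈ distTriang C)
    (h1 : T.obj₁ ∈ FF P) (h3 : T.obj₃ ∈ FF P) : T.obj₂ ∈ FF P := fun n =>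
  Dec.ext' hP _ (Triangle.shift_distinguished T hT n) (h1 n) (h3 n)

lemma FF.shift {P : Set C} {B : C} (h : B ∈ FF P) (m : ℤ) : B⟦m⟧ ∈ FF P := fun n =>
  (h (m + n)).iso ((shiftFunctorAdd' C m n (m + n) rfl).app B)

lemma HV.of_isZero_left {X Y : C} (h : IsZero X) : HV X Y := fun _ => h.eq_of_src _ _

lemma HV.of_isZero_right {X Y : C} (h : IsZero Y) : HV X Y := fun _ => h.eq_of_tgt _ _

lemma FF.of_mem {P : Set C} (hP : IsPresiltingSet P) {p : C} (hp : p ∈ P) : p ∈ FF P := by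
  intro n
  by_cases hn : 1 ≤ n
  · refine ⟨0, ⟨fun Y _ => HV.of_isZero_left (isZero_zero C), p, sums.of hp, 0, ?_⟩, p⟦n⟧, ?_,
      0, 𝟙 _, 0, contractible_distinguished₁ _⟩
    · intro A _ f
      exact ⟨0, (isZero_zero C).eq_of_src _ _⟩
    · exact LL.anti (by omega) (LL.shift (mem_LL_of_presilting hP hp) n n (by omega))
  · refine ⟨p⟦n⟧, ⟨fun Y hY => hY p hp n (by omega), p, sums.of hp, ?_⟩, 0, ?_,
      𝟙 _, 0, 0, contractible_distinguished _⟩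
    · by_cases h0 : n = 0
      · subst h0
        refine ⟨(shiftFunctorZero C ℤ).hom.app p, fun A _ f =>
          ⟨(shiftFunctorZero C ℤ).inv.app p ≫ f, ?_⟩⟩
        rw [← Category.assoc, Iso.hom_inv_id_app]
        exact (Category.id_comp f).symm
      · refine ⟨0, fun A hA f => ⟨0, ?_⟩⟩
        rw [hA p hp n (by omega) f, zero_comp]
    · intro q _ i _
      exact HV.of_isZero_right (isZero_zero C)

lemma retract_ext {A B D A₁ D₁ : C} {f : A ⟶ B} {g : B ⟶ D} {h : D ⟶ A⟦(1 : ℤ)⟧}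
    (hT : Triangle.mk f g h ∈ distTriang C) (rA : Retract A A₁) (rD : Retract D D₁) :
    ∃ (B₁ : C) (f₁ : A₁ ⟶ B₁) (g₁ : B₁ ⟶ D₁) (h₁ : D₁ ⟶ A₁⟦(1 : ℤ)⟧),
      Triangle.mk f₁ g₁ h₁ ∈ distTriang C ∧ Nonempty (Retract B B₁) := by
  obtain ⟨B₁, f₁, g₁, hT₁⟩ := distinguished_cocone_triangle₂ (rD.r ≫ h ≫ rA.i⟦(1 : ℤ)⟧')
  refine ⟨B₁, f₁, g₁, _, hT₁, ?_⟩
  obtain ⟨b, hb1, hb2⟩ := dt_fill₂ hT hT₁ rA.i rD.i (by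
    rw [← Category.assoc rD.i, rD.retract, Category.id_comp])
  obtain ⟨c, hc1, hc2⟩ := dt_fill₂ hT₁ hT rA.r rD.r (by
    rw [Category.assoc, Category.assoc, ← Functor.map_comp, rA.retract,
      CategoryTheory.Functor.map_id, Category.comp_id])
  have hiso : IsIso (b ≫ c) := by
    let φ : Triangle.mk f g h ⟶ Triangle.mk f g h :=
      { hom₁ := 𝟙 _
        hom₂ := b ≫ c
        hom₃ := 𝟙 _
        comm₁ := by
          change f ≫ b ≫ c = 𝟙 A ≫ f
          rw [← Category.assoc, hb1, Category.assoc, hc1, ← Category.assoc, rA.retract]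
        comm₂ := by
          change g ≫ 𝟙 D = (b ≫ c) ≫ g
          rw [Category.assoc, ← hc2, ← Category.assoc, ← hb2, Category.assoc, rD.retract]
        comm₃ := by
          change h ≫ (𝟙 A)⟦(1 : ℤ)⟧' = 𝟙 D ≫ h
          rw [CategoryTheory.Functor.map_id, Category.comp_id, Category.id_comp] }
    exact isIso₂_of_isIso₁₃ φ hT hT (inferInstanceAs (IsIso (𝟙 _)))
      (inferInstanceAs (IsIso (𝟙 _)))
  exact ⟨⟨b, c ≫ inv (b ≫ c), by rw [← Category.assoc, IsIso.hom_inv_id]⟩⟩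

lemma retract_biprod_left (X Y : C) : Nonempty (Retract X (X ⊞ Y)) :=
  ⟨⟨biprod.inl, biprod.fst, biprod.inl_fst⟩⟩

lemma exists_FF {P : Set C} (hP : IsSiltingSet P) (X : C) :
    ∃ B ∈ FF P, Nonempty (Retract X B) := by
  refine hP.2 {X | ∃ B ∈ FF P, Nonempty (Retract X B)} ?_ ?_ X
  · refine ⟨?_, ?_, ?_, ?_⟩
    · rintro X Y e ⟨B, hB, ⟨r⟩⟩
      exact ⟨B, hB, ⟨(Retract.ofIso e.symm).trans r⟩⟩
    · rintro X ⟨B, hB, ⟨r⟩⟩ n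
      exact ⟨B⟦n⟧, FF.shift hB n, ⟨r.map _⟩⟩
    · rintro T hT ⟨A₁, hA, ⟨rA⟩⟩ ⟨D₁, hD, ⟨rD⟩⟩
      obtain ⟨B₁, f₁, g₁, h₁, hT₁, hr⟩ := retract_ext (f := T.mor₁) (g := T.mor₂) (h := T.mor₃)
        hT rA rD
      exact ⟨B₁, FF.ext hP.1 _ hT₁ hA hD, hr⟩
    · rintro X Y _ ⟨B, hB, ⟨r⟩⟩
      exact ⟨B, hB, ⟨Retract.trans ⟨biprod.inl, biprod.fst, biprod.inl_fst⟩ r⟩⟩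
  · intro p hp
    exact ⟨p, FF.of_mem hP.1 hp, ⟨Retract.refl p⟩⟩

/-- Right `P`-approximation of objects of `T_{≤ 0}`. -/
lemma exists_approx {P : Set C} (hP : IsSiltingSet P) {A : C} (hA : A ∈ LL P 0) :
    ∃ (p A' : C) (t : p ⟶ A) (v : A ⟶ A') (w : A' ⟶ p⟦(1 : ℤ)⟧),
      sums P p ∧ A' ∈ LL P 1 ∧ Triangle.mk t v w ∈ distTriang C := by
  obtain ⟨B, hB, ⟨r⟩⟩ := exists_FF hP A
  obtain ⟨X, ⟨-, p, hp, e, he⟩, Y, hY, u, v, w, hT⟩ :=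
    (hB 0).iso ((shiftFunctorZero C ℤ).app B)
  dsimp at u v
  obtain ⟨t, ht⟩ := he A hA (u ≫ r.r)
  obtain ⟨A', v', w', hT'⟩ := distinguished_cocone_triangle t
  refine ⟨p, A', t, v', w', hp, ?_, hT'⟩
  intro q hq i hi f
  have h1 : HV (q⟦i⟧) (p⟦(1 : ℤ)⟧) := LL.shift (sums_mem_LL hP.1 hp) 1 1 (by omega) q hq i hi
  obtain ⟨x, rfl⟩ := dt_lift₃ hT' f (h1 _)
  by_cases h0 : i < 0
  · rw [hA q hq i h0 x, zero_comp]
  · obtain ⟨y, hy⟩ := dt_lift₂ hT (x ≫ r.i) (hY q hq i hi _)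
    have : x = y ≫ e ≫ t := by
      rw [← ht, ← Category.assoc, ← hy, Category.assoc, r.retract, Category.comp_id]
    rw [this, Category.assoc, Category.assoc, dt_zero₁₂ hT', comp_zero, comp_zero]

lemma exists_approx_shift {P : Set C} (hP : IsSiltingSet P) (n : ℤ) {A : C} (hA : A ∈ LL P n) :
    ∃ (p A' : C) (t : p⟦n⟧ ⟶ A) (v : A ⟶ A') (w : A' ⟶ p⟦n⟧⟦(1 : ℤ)⟧),
      sums P p ∧ A' ∈ LL P (n + 1) ∧ Triangle.mk t v w ∈ distTriang C := by
  obtain ⟨p, A', t, v, w, hp, hA', hT⟩ := exists_approx hP (LL.shift hA (-n) 0 (by omega))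
  have hs := Triangle.shift_distinguished _ hT n
  let T := (CategoryTheory.shiftFunctor (Triangle C) n).obj (Triangle.mk t v w)
  let e : A⟦-n⟧⟦n⟧ ≅ A := (shiftFunctorCompIsoId C (-n) n (by omega)).app A
  refine ⟨p, A'⟦n⟧, T.mor₁ ≫ e.hom, e.inv ≫ T.mor₂, T.mor₃, hp,
    LL.shift hA' n (n + 1) (by omega), dt_iso₂ (f := T.mor₁) (g := T.mor₂) (h := T.mor₃) hs e⟩

lemma exists_bound {P : Set C} (hP : IsSiltingSet P) (X : C) :
    ∃ N : ℤ, ∀ Y ∈ LL P N, HV X Y := by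
  refine hP.2 {X | ∃ N : ℤ, ∀ Y ∈ LL P N, HV X Y} ?_ ?_ X
  · refine ⟨?_, ?_, ?_, ?_⟩
    · rintro X Y e ⟨N, hN⟩
      exact ⟨N, fun Z hZ => (hN Z hZ).iso e (Iso.refl _)⟩
    · rintro X ⟨N, hN⟩ n
      refine ⟨N + n, fun Z hZ => ?_⟩
      exact (HV.shift_left_iff X Z n (-n) (by omega)).2 (hN _ (LL.shift hZ _ _ (by omega)))
    · rintro T hT ⟨N, hN⟩ ⟨M, hM⟩
      exact ⟨max N M, fun Z hZ => HV.ext_left T hT (hN _ (LL.anti (le_max_left _ _) hZ))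
        (hM _ (LL.anti (le_max_right _ _) hZ))⟩
    · rintro X Y _ ⟨N, hN⟩
      exact ⟨N, fun Z hZ => (hN Z hZ).retract_left ⟨biprod.inl, biprod.fst, biprod.inl_fst⟩⟩
  · intro p hp
    exact ⟨1, fun Y hY => (HV.shift_zero_left_iff _ _).1 (hY p hp 0 (by omega))⟩

/-- Orthogonality of the co-t-structure. -/
lemma coT_orth {P : Set C} (hP : IsSiltingSet P) {Z A : C} (hZ : Z ∈ coAisleGE P)
    (hA : A ∈ LL P 1) : HV Z A := by
  obtain ⟨N, hN⟩ := exists_bound hP Z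
  have key : ∀ m : ℕ, ∀ n : ℤ, 1 ≤ n → N ≤ n + m → ∀ A ∈ LL P n, HV Z A := by
    intro m
    induction m with
    | zero =>
      intro n _ h A hA
      exact hN A (LL.anti (by simpa using h) hA)
    | succ m ih =>
      intro n hn h A hA f
      obtain ⟨p, A', t, v, w, hp, hA', hT⟩ := exists_approx_shift hP n hA
      obtain ⟨g, rfl⟩ := dt_lift₂ hT f (ih (n + 1) (by omega) (by push_cast at h; omega) A' hA' _)
      have : HV Z (p⟦n⟧) := HV.sums_right n (fun q hq => hZ q hq n hn) hp
      rw [this g, zero_comp]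
  exact key (N - 1).toNat 1 le_rfl (by omega) A hA

lemma retract_of_GE_LE {P : Set C} (hP : IsSiltingSet P) {X : C} (h1 : X ∈ coAisleGE P)
    (h2 : X ∈ LL P 0) : ∃ p, sums P p ∧ Nonempty (Retract X p) := by
  obtain ⟨p, A', t, v, w, hp, hA', hT⟩ := exists_approx hP h2
  obtain ⟨s, hs⟩ := dt_lift₂ hT (𝟙 X) (coT_orth hP h1 hA' _)
  exact ⟨p, hp, ⟨⟨s, t, hs.symm⟩⟩⟩

end

lemma serre_iff (S : SerreFunctor k C) (X Y : C) : HV X Y ↔ HV Y (S.ν.functor.obj X) := by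
  constructor
  · intro h f
    apply (S.duality X Y).injective
    rw [map_zero]
    ext g
    rw [h g, map_zero, map_zero]
  · intro h g
    rw [← Module.forall_dual_apply_eq_zero_iff k]
    intro φ
    obtain ⟨f, rfl⟩ := (S.duality X Y).surjective φ
    rw [h f, map_zero]
    rfl

instance nud_isEquivalence (S : SerreFunctor k C) (d : ℕ) : (nud S d).IsEquivalence := by
  unfold nud
  infer_instance

instance nud_additive (S : SerreFunctor k C) (d : ℕ) : (nud S d).Additive := by
  have := S.additive
  unfold nud
  infer_instance

instance nudInv_isEquivalence (S : SerreFunctor k C) (d : ℕ) : (nudInv S d).IsEquivalence := by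
  unfold nudInv
  infer_instance

instance nudInv_additive (S : SerreFunctor k C) (d : ℕ) : (nudInv S d).Additive := by
  have := S.additive
  have : S.ν.inverse.Additive := S.ν.inverse_additive
  unfold nudInv
  infer_instance

/-- `ν_d ν_d^{-1} X ≅ X`. -/
noncomputable def nudNudInv (S : SerreFunctor k C) (d : ℕ) (X : C) :
    (nud S d).obj ((nudInv S d).obj X) ≅ X :=
  S.ν.functor.mapIso ((shiftFunctorCompIsoId C (d : ℤ) (-(d : ℤ)) (by omega)).app
    (S.ν.inverse.obj X)) ≪≫ S.ν.counitIso.app X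

/-- `ν_d^{-1} ν_d X ≅ X`. -/
noncomputable def nudInvNud (S : SerreFunctor k C) (d : ℕ) (X : C) :
    (nudInv S d).obj ((nud S d).obj X) ≅ X :=
  (CategoryTheory.shiftFunctor C (d : ℤ)).mapIso
    (S.ν.unitIso.symm.app (X⟦-(d : ℤ)⟧)) ≪≫
    (shiftFunctorCompIsoId C (-(d : ℤ)) (d : ℤ) (by omega)).app X

lemma nud_shift_right (S : SerreFunctor k C) (d : ℕ) (X Y : C) (n : ℤ) :
    HV Y ((nud S d).obj (X⟦n⟧)) ↔ HV Y (((nud S d).obj X)⟦n⟧) := by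
  have h1 : HV Y ((nud S d).obj (X⟦n⟧)) ↔ HV (X⟦n⟧⟦-(d : ℤ)⟧) Y := (serre_iff S _ _).symm
  have h2 : HV (Y⟦-n⟧) ((nud S d).obj X) ↔ HV (X⟦-(d : ℤ)⟧) (Y⟦-n⟧) := (serre_iff S _ _).symm
  rw [h1, HV.iso_iff (shiftComm X n (-(d : ℤ))) (Iso.refl Y),
    HV.shift_left_iff _ Y n (-n) (by omega), ← h2, HV.shift_left_iff _ _ (-n) n (by omega)]

lemma nud_K (S : SerreFunctor k C) (d : ℕ) (X Y : C) (n : ℤ) :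
    HV ((nud S d).obj X) (((nud S d).obj Y)⟦n⟧) ↔ HV X (Y⟦n⟧) := by
  rw [← nud_shift_right, HV.map_iff]

lemma nud_serre (S : SerreFunctor k C) (d : ℕ) (X Y : C) :
    HV X Y ↔ HV Y (((nud S d).obj X)⟦(d : ℤ)⟧) := by
  rw [← nud_shift_right]
  have h1 : HV Y ((nud S d).obj (X⟦(d : ℤ)⟧)) ↔ HV (X⟦(d : ℤ)⟧⟦-(d : ℤ)⟧) Y :=
    (serre_iff S _ _).symm
  rw [h1]
  exact HV.iso_iff ((shiftFunctorCompIsoId C (d : ℤ) (-(d : ℤ)) (by omega)).app X).symm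
    (Iso.refl _)

/-- Iterates of `ν_d` as functors. -/
def FN (S : SerreFunctor k C) (d : ℕ) : ℕ → (C ⥤ C)
  | 0 => 𝟭 C
  | n + 1 => FN S d n ⋙ nud S d

instance FN_isEquivalence (S : SerreFunctor k C) (d n : ℕ) : (FN S d n).IsEquivalence := by
  induction n with
  | zero => exact inferInstanceAs (𝟭 C).IsEquivalence
  | succ n ih => exact inferInstanceAs (FN S d n ⋙ nud S d).IsEquivalence

instance FN_additive (S : SerreFunctor k C) (d n : ℕ) : (FN S d n).Additive := by
  induction n with
  | zero => exact inferInstanceAs (𝟭 C).Additive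
  | succ n ih => exact inferInstanceAs (FN S d n ⋙ nud S d).Additive

lemma FN_obj (S : SerreFunctor k C) (d n : ℕ) (X : C) :
    (FN S d n).obj X = iterObj (nud S d) n X := by
  induction n with
  | zero => rfl
  | succ n ih => exact congrArg (nud S d).obj ih

lemma iterObj_add (F : C ⥤ C) (m n : ℕ) (X : C) :
    iterObj F (m + n) X = iterObj F m (iterObj F n X) := by
  induction m with
  | zero => rw [Nat.zero_add]; rfl
  | succ m ih => rw [Nat.succ_add]; exact congrArg F.obj ih

/-- Iteration preserves isomorphisms. -/
def iterIso (F : C ⥤ C) {X Y : C} (e : X ≅ Y) : ∀ n : ℕ, iterObj F n X ≅ iterObj F n Y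
  | 0 => e
  | n + 1 => F.mapIso (iterIso F e n)

lemma iter_K (S : SerreFunctor k C) (d m : ℕ) (X Y : C) (n : ℤ) :
    HV (iterObj (nud S d) m X) ((iterObj (nud S d) m Y)⟦n⟧) ↔ HV X (Y⟦n⟧) := by
  induction m with
  | zero => rfl
  | succ m ih => exact (nud_K S d _ _ n).trans ih

lemma iter_nud_nudInv (S : SerreFunctor k C) (d n : ℕ) (X : C) :
    Nonempty (iterObj (nud S d) n (iterObj (nudInv S d) n X) ≅ X) := by
  induction n generalizing X with
  | zero => exact ⟨Iso.refl _⟩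
  | succ n ih =>
    obtain ⟨e⟩ := ih X
    rw [iterObj_add (nud S d) n 1]
    exact ⟨iterIso (nud S d) (nudNudInv S d _) n ≪≫ e⟩

/-- The union of the orbits. -/
def OrbSet (S : SerreFunctor k C) (d : ℕ) (P : Set C) : Set C := ⋃ A ∈ P, nudOrbit S d A

lemma mem_OrbSet {S : SerreFunctor k C} {d : ℕ} {P : Set C} {Y : C} :
    Y ∈ OrbSet S d P ↔ ∃ A ∈ P, Y ∈ nudOrbit S d A := by
  simp [OrbSet]

lemma OrbSet.of_mem (S : SerreFunctor k C) (d : ℕ) {P : Set C} {p : C} (hp : p ∈ P) :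
    p ∈ OrbSet S d P :=
  mem_OrbSet.2 ⟨p, hp, 0, Or.inl ⟨Iso.refl _⟩⟩

lemma OrbSet.nud {S : SerreFunctor k C} {d : ℕ} {P : Set C} {Y : C} (h : Y ∈ OrbSet S d P) :
    (nud S d).obj Y ∈ OrbSet S d P := by
  obtain ⟨A, hA, n, ⟨⟨e⟩⟩ | ⟨⟨e⟩⟩⟩ := mem_OrbSet.1 h
  · exact mem_OrbSet.2 ⟨A, hA, n + 1, Or.inl ⟨(_root_.nud S d).mapIso e⟩⟩
  · cases n with
    | zero => exact mem_OrbSet.2 ⟨A, hA, 1, Or.inl ⟨(_root_.nud S d).mapIso e⟩⟩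
    | succ n =>
      exact mem_OrbSet.2 ⟨A, hA, n, Or.inr ⟨(_root_.nud S d).mapIso e ≪≫ nudNudInv S d _⟩⟩

lemma OrbSet.nudInv {S : SerreFunctor k C} {d : ℕ} {P : Set C} {Y : C}
    (h : Y ∈ OrbSet S d P) : (nudInv S d).obj Y ∈ OrbSet S d P := by
  obtain ⟨A, hA, n, ⟨⟨e⟩⟩ | ⟨⟨e⟩⟩⟩ := mem_OrbSet.1 h
  · cases n with
    | zero => exact mem_OrbSet.2 ⟨A, hA, 1, Or.inr ⟨(_root_.nudInv S d).mapIso e⟩⟩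
    | succ n =>
      exact mem_OrbSet.2 ⟨A, hA, n, Or.inl ⟨(_root_.nudInv S d).mapIso e ≪≫ nudInvNud S d _⟩⟩
  · exact mem_OrbSet.2 ⟨A, hA, n + 1, Or.inr ⟨(_root_.nudInv S d).mapIso e⟩⟩

lemma OrbSet.norm {S : SerreFunctor k C} {d : ℕ} {P : Set C} {Y : C} (h : Y ∈ OrbSet S d P) :
    ∃ A ∈ P, ∃ a b : ℕ, Nonempty (iterObj (_root_.nud S d) a Y ≅ iterObj (_root_.nud S d) b A) := by
  obtain ⟨A, hA, n, ⟨⟨e⟩⟩ | ⟨⟨e⟩⟩⟩ := mem_OrbSet.1 h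
  · exact ⟨A, hA, 0, n, ⟨e⟩⟩
  · obtain ⟨e'⟩ := iter_nud_nudInv S d n A
    exact ⟨A, hA, n, 0, ⟨iterIso _ e n ≪≫ e'⟩⟩

lemma mem_addSet_iff {G : Set C} {X : C} :
    X ∈ addSet G ↔ ∃ Y, sums G Y ∧ Nonempty (Retract X Y) := by
  constructor
  · rintro ⟨Y, Z, hY, ⟨e⟩⟩
    exact ⟨Y, hY, ⟨⟨biprod.inl ≫ e.inv, e.hom ≫ biprod.fst, by simp⟩⟩⟩
  · rintro ⟨Y, hY, ⟨r⟩⟩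
    obtain ⟨Z, g, h, hT⟩ := distinguished_cocone_triangle r.i
    have h0 : h = 0 := by
      have := dt_zero₃₁ hT
      rw [← Category.comp_id h, ← CategoryTheory.Functor.map_id, ← r.retract, Functor.map_comp,
        ← Category.assoc, this, zero_comp]
    obtain ⟨e, -, -⟩ := exists_iso_binaryBiproduct_of_distTriang _ hT h0
    exact ⟨Y, Z, hY, ⟨e⟩⟩

lemma addSet.retract {G : Set C} {X Y : C} (h : Y ∈ addSet G) (r : Retract X Y) :
    X ∈ addSet G := by
  obtain ⟨Z, hZ, ⟨r'⟩⟩ := mem_addSet_iff.1 h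
  exact mem_addSet_iff.2 ⟨Z, hZ, ⟨r.trans r'⟩⟩

lemma addSet.sum {G : Set C} {X Y Z : C} (hX : X ∈ addSet G) (hY : Y ∈ addSet G)
    (a : Z ⟶ X) (b : X ⟶ Z) (c : Z ⟶ Y) (d : Y ⟶ Z) (h : a ≫ b + c ≫ d = 𝟙 Z) :
    Z ∈ addSet G := by
  obtain ⟨X', hX', ⟨r⟩⟩ := mem_addSet_iff.1 hX
  obtain ⟨Y', hY', ⟨r'⟩⟩ := mem_addSet_iff.1 hY
  refine mem_addSet_iff.2 ⟨X' ⊞ Y', sums.biprod hX' hY',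
    ⟨⟨biprod.lift (a ≫ r.i) (c ≫ r'.i), biprod.desc (r.r ≫ b) (r'.r ≫ d), ?_⟩⟩⟩
  rw [biprod.lift_desc, Category.assoc, Category.assoc, ← Category.assoc r.i,
    ← Category.assoc r'.i, r.retract, r'.retract, Category.id_comp, Category.id_comp, h]

lemma sums.mem_addSet {G : Set C} {X : C} (h : sums G X) : X ∈ addSet G :=
  mem_addSet_iff.2 ⟨X, h, ⟨Retract.refl _⟩⟩

lemma sums.mono {G G' : Set C} (hG : G ⊆ G') {X : C} (h : sums G X) : sums G' X := by
  induction h with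
  | of h => exact sums.of (hG h)
  | biprod _ _ h1 h2 => exact sums.biprod h1 h2

lemma addSet.map {G : Set C} (F : C ⥤ C) [F.Additive] (hF : ∀ X ∈ G, F.obj X ∈ G) {X : C}
    (h : X ∈ addSet G) : F.obj X ∈ addSet G := by
  obtain ⟨Y, hY, ⟨r⟩⟩ := mem_addSet_iff.1 h
  refine addSet.retract ?_ (r.map F)
  clear r
  induction hY with
  | of h => exact (sums.of (hF _ h)).mem_addSet
  | biprod _ _ h1 h2 =>
    refine addSet.sum h1 h2 (F.map biprod.fst) (F.map biprod.inl) (F.map biprod.snd)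
      (F.map biprod.inr) ?_
    rw [← F.map_comp, ← F.map_comp, ← F.map_add, biprod.total, F.map_id]

lemma addSet_of_FN {S : SerreFunctor k C} {d : ℕ} {P : Set C} (n : ℕ) {X : C}
    (h : (FN S d n).obj X ∈ addSet (OrbSet S d P)) : X ∈ addSet (OrbSet S d P) := by
  induction n with
  | zero => exact h
  | succ n ih =>
    apply ih
    exact addSet.retract (addSet.map (nudInv S d) (fun _ => OrbSet.nudInv) h)
      (Retract.ofIso (nudInvNud S d _).symm)

lemma finrank_lt_of_retract [∀ X Y : C, FiniteDimensional k (X ⟶ Y)] {A W : C}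
    (r : Retract A W) (h : r.r ≫ r.i ≠ 𝟙 W) :
    Module.finrank k (A ⟶ A) < Module.finrank k (W ⟶ W) := by
  let φ : (A ⟶ A) →ₗ[k] (W ⟶ W) :=
    { toFun := fun f => r.r ≫ f ≫ r.i
      map_add' := by intro f g; simp
      map_smul' := by intro c f; simp }
  have hφ : Function.Injective φ := by
    intro f g hfg
    have hfg' : r.r ≫ f ≫ r.i = r.r ≫ g ≫ r.i := hfg
    have := congrArg (fun x => r.i ≫ x ≫ r.r) hfg'
    simpa using this
  rw [← LinearMap.finrank_range_of_inj hφ]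
  apply Submodule.finrank_lt
  intro htop
  have : 𝟙 W ∈ LinearMap.range φ := by rw [htop]; trivial
  obtain ⟨f, hf⟩ := this
  have hf' : r.r ≫ f ≫ r.i = 𝟙 W := hf
  apply h
  have h1 : f ≫ r.i = r.i := by
    rw [← Category.id_comp (f ≫ r.i), ← r.retract, Category.assoc, hf', Category.comp_id]
  rw [h1] at hf'
  exact hf'

section

open scoped ZeroObject

lemma silting_nonempty {P : Set C} (hP : IsSiltingSet P) : P.Nonempty := by
  by_contra hne
  rw [Set.not_nonempty_iff_eq_empty] at hne
  have := hP.2 (∅ : Set C) ⟨fun _ h => h, fun _ h _ => h.elim, fun _ _ h _ => h,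
    fun _ _ _ h => h⟩ (by rw [hne]) (0 : C)
  exact this

end

/-- The `d`-silting hypothesis. -/
def DS (S : SerreFunctor k C) (d : ℕ) (P : Set C) : Prop :=
  ∀ A ∈ P, ∀ B ∈ P, ∀ i j : ℕ, 1 ≤ i → 1 ≤ j →
      ∀ f : iterObj (nud S d) j A ⟶ B⟦(i : ℤ)⟧, f = 0

lemma rigid_zero {S : SerreFunctor k C} {d : ℕ} {P : Set C} (hP : IsPresiltingSet P)
    (hd : DS S d P) {A A' : C} (hA : A ∈ P) (hA' : A' ∈ P) (a : ℕ) (i : ℤ) (hi : 1 ≤ i) :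
    HV (iterObj (nud S d) a A) (A'⟦i⟧) := by
  cases a with
  | zero => exact hP A hA A' hA' i hi
  | succ a =>
    obtain ⟨n, rfl⟩ := Int.eq_ofNat_of_zero_le (show 0 ≤ i by omega)
    exact hd A hA A' hA' n (a + 1) (by omega) (by omega)

lemma rigid_iter {S : SerreFunctor k C} {d : ℕ} {P : Set C} (hP : IsPresiltingSet P)
    (hd : DS S d P) {A A' : C} (hA : A ∈ P) (hA' : A' ∈ P) (a b : ℕ) (i : ℤ) (hi : 1 ≤ i)
    (hi' : i ≤ (d : ℤ) - 1) :
    HV (iterObj (nud S d) a A) ((iterObj (nud S d) b A')⟦i⟧) := by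
  induction b generalizing a with
  | zero => exact rigid_zero hP hd hA hA' a i hi
  | succ b ih =>
    cases a with
    | succ a => exact (nud_K S d _ _ i).2 (ih a)
    | zero =>
      have h := rigid_zero hP hd hA' hA b ((d : ℤ) - i) (by omega)
      rw [nud_serre S d] at h
      exact (HV.shift_iff A _ ((d : ℤ) - i) (d : ℤ) i (by omega)).1 h

lemma rigid_orb {S : SerreFunctor k C} {d : ℕ} {P : Set C} (hP : IsPresiltingSet P)
    (hd : DS S d P) {X Y : C} (hX : X ∈ OrbSet S d P) (hY : Y ∈ OrbSet S d P)
    (i : ℤ) (hi : 1 ≤ i) (hi' : i ≤ (d : ℤ) - 1) : HV X (Y⟦i⟧) := by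
  obtain ⟨A, hA, a, b, ⟨e⟩⟩ := OrbSet.norm hX
  obtain ⟨A', hA', a', b', ⟨e'⟩⟩ := OrbSet.norm hY
  have h := rigid_iter hP hd hA hA' (a' + b) (a + b') i hi hi'
  rw [iterObj_add, iterObj_add (nud S d) a b'] at h
  have h' := h.iso (iterIso (nud S d) e a').symm
    ((CategoryTheory.shiftFunctor C i).mapIso (iterIso (nud S d) e' a).symm)
  rw [← iterObj_add, ← iterObj_add, Nat.add_comm a a'] at h'
  exact (iter_K S d (a' + a) X Y i).1 h'

lemma rigid_add {S : SerreFunctor k C} {d : ℕ} {P : Set C} (hP : IsPresiltingSet P)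
    (hd : DS S d P) {X Y : C} (hX : X ∈ addSet (OrbSet S d P)) (hY : Y ∈ addSet (OrbSet S d P))
    (i : ℤ) (hi : 1 ≤ i) (hi' : i ≤ (d : ℤ) - 1) : HV X (Y⟦i⟧) := by
  obtain ⟨X', hX', ⟨r⟩⟩ := mem_addSet_iff.1 hX
  obtain ⟨Y', hY', ⟨r'⟩⟩ := mem_addSet_iff.1 hY
  refine HV.retract_right (HV.retract_left ?_ r) (r'.map (CategoryTheory.shiftFunctor C i))
  refine HV.sums_left (P := OrbSet S d P) ?_ hX'
  intro p hp
  exact HV.sums_right i (fun q hq => rigid_orb hP hd hp hq i hi hi') hY' |> fun final => final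

/-- Right Ext-orthogonality to the orbit set. -/
def Perp (S : SerreFunctor k C) (d : ℕ) (P : Set C) (W : C) : Prop :=
  ∀ g ∈ OrbSet S d P, ∀ i : ℤ, 1 ≤ i → i ≤ (d : ℤ) - 1 → HV g (W⟦i⟧)

lemma Perp.retract {S : SerreFunctor k C} {d : ℕ} {P : Set C} {W W' : C} (h : Perp S d P W)
    (r : Retract W' W) : Perp S d P W' :=
  fun g hg i hi hi' => (h g hg i hi hi').retract_right (r.map (CategoryTheory.shiftFunctor C i))

lemma Perp.nud {S : SerreFunctor k C} {d : ℕ} {P : Set C} {W : C} (h : Perp S d P W) :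
    Perp S d P ((nud S d).obj W) := fun g hg i hi hi' =>
  ((nud_K S d _ W i).2 (h _ (OrbSet.nudInv hg) i hi hi')).iso (nudNudInv S d g) (Iso.refl _)

lemma Perp.nudInv {S : SerreFunctor k C} {d : ℕ} {P : Set C} {W : C} (h : Perp S d P W) :
    Perp S d P ((nudInv S d).obj W) := fun g hg i hi hi' => by
  rw [← nud_K S d]
  exact (h _ (OrbSet.nud hg) i hi hi').iso (Iso.refl _)
    ((CategoryTheory.shiftFunctor C i).mapIso (nudNudInv S d W).symm)

lemma Perp.FN {S : SerreFunctor k C} {d : ℕ} {P : Set C} {W : C} (h : Perp S d P W) (n : ℕ) :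
    Perp S d P ((FN S d n).obj W) := by
  induction n with
  | zero => exact h
  | succ n ih => exact ih.nud

lemma nudInv_mem_LL {S : SerreFunctor k C} {d : ℕ} {P : Set C} (hd : DS S d P) {p : C}
    (hp : p ∈ P) : (nudInv S d).obj p ∈ LL P 0 := by
  intro q hq i hi
  rw [HV.shift_left_iff q _ i (-i) (by omega), ← nud_K S d]
  have h : HV ((nud S d).obj q) (p⟦-i⟧) := by
    obtain ⟨n, hn⟩ := Int.eq_ofNat_of_zero_le (show 0 ≤ -i by omega)
    rw [hn]
    exact hd q hq p hp n 1 (by omega) (by omega)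
  exact h.iso (Iso.refl _)
    ((CategoryTheory.shiftFunctor C (-i)).mapIso (nudNudInv S d p).symm)

/-- The truncation step: the truncation triangle of `ν_d X` splits. -/
lemma trunc_step {S : SerreFunctor k C} {d : ℕ} {P B : Set C} (hP : IsSiltingSet P)
    (hd : DS S d P) (hadj : AdjacentTStructure P B) {Z A Y Y' : C} (hY : Perp S d P Y)
    (hA : A ∈ LL P 0) (hY' : Y' ∈ B) (e : (nud S d).obj Z ≅ Y')
    {f : A ⟶ Y} {g : Y ⟶ Y'} {h : Y' ⟶ A⟦(1 : ℤ)⟧} (hT : Triangle.mk f g h ∈ distTriang C) :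
    Z ∈ coAisleGE P ∧ h = 0 := by
  have hA1 : A⟦(1 : ℤ)⟧ ∈ LL P 1 := LL.shift hA 1 1 (by omega)
  have key : ∀ p ∈ P, ∀ i : ℤ, -(d : ℤ) < i → HV (p⟦i⟧) Y' := by
    intro p hp i hi
    by_cases h0 : 0 ≤ i
    · refine hadj.orth _ ?_ _ hY'
      rw [mem_LL_zero_iff]
      exact LL.anti h0 (LL.shift (mem_LL_of_presilting hP.1 hp) i i (by omega))
    · intro x
      obtain ⟨y, hy⟩ := dt_lift₃ hT x (hA1 p hp i (by omega) _)
      have h1 : HV (p⟦i⟧) Y := by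
        rw [HV.shift_left_iff p Y i (-i) (by omega)]
        exact hY p (OrbSet.of_mem S d hp) (-i) (by omega) (by omega)
      rw [hy, h1 y, zero_comp]
  have hZ : Z ∈ coAisleGE P := by
    intro p hp i hi
    change HV Z (p⟦i⟧)
    rw [nud_serre S d, HV.shift_iff p _ i (d : ℤ) ((d : ℤ) - i) (by omega),
      ← HV.shift_left_iff p _ (i - (d : ℤ)) ((d : ℤ) - i) (by omega)]
    exact (key p hp (i - d) (by omega)).iso (Iso.refl _) e.symm
  refine ⟨hZ, ?_⟩
  have hNZ : Y' ∈ coAisleGE P := by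
    intro p hp i hi
    change HV Y' (p⟦i⟧)
    have h1 : HV Z (((nudInv S d).obj p)⟦i⟧) :=
      coT_orth hP hZ (LL.anti hi (LL.shift (nudInv_mem_LL hd hp) i i (by omega)))
    rw [← nud_K S d] at h1
    exact h1.iso e ((CategoryTheory.shiftFunctor C i).mapIso (nudNudInv S d p))
  exact coT_orth hP hNZ hA1 h

lemma split_triangle {A Y D : C} {f : A ⟶ Y} {g : Y ⟶ D} {h : D ⟶ A⟦(1 : ℤ)⟧}
    (hT : Triangle.mk f g h ∈ distTriang C) (h0 : h = 0) :
    ∃ (s : D ⟶ Y) (ρ : Y ⟶ A), s ≫ g = 𝟙 D ∧ f ≫ ρ = 𝟙 A ∧ ρ ≫ f + g ≫ s = 𝟙 Y := by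
  obtain ⟨s, hs⟩ := dt_lift₃ hT (𝟙 D) (by rw [h0, comp_zero])
  obtain ⟨ρ, hρ⟩ := dt_lift₂ hT (𝟙 Y - g ≫ s) (by
    rw [Preadditive.sub_comp, Category.assoc, ← hs, Category.comp_id, Category.id_comp, sub_self])
  have hm : Mono f := Triangle.mono₁ _ hT h0
  refine ⟨s, ρ, hs.symm, ?_, by rw [← hρ]; abel⟩
  rw [← cancel_mono f, Category.assoc, ← hρ, Preadditive.comp_sub, ← Category.assoc,
    dt_zero₁₂ hT, zero_comp, sub_zero, Category.comp_id, Category.id_comp]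

lemma main_induction [∀ X Y : C, FiniteDimensional k (X ⟶ Y)]
    {S : SerreFunctor k C} {d : ℕ} {P B : Set C} (hP : IsSiltingSet P)
    (hd : DS S d P) (hnd : NudNonDegenerate S d P) (hadj : AdjacentTStructure P B) (n : ℕ) :
    ∀ W : C, Module.finrank k (W ⟶ W) = n → Perp S d P W → ∀ m : ℕ, (FN S d m).obj W ∈ LL P 0 →
      W ∈ addSet (OrbSet S d P) := by
  induction n using Nat.strong_induction_on with
  | _ n IH =>
  intro W hn hW m hm
  by_cases hzero : IsZero W
  · obtain ⟨p, hp⟩ := silting_nonempty hP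
    exact addSet.retract (sums.of (OrbSet.of_mem S d hp)).mem_addSet
      ⟨0, 0, hzero.eq_of_src _ _⟩
  obtain ⟨M, hM, hM'⟩ : ∃ M, (FN S d M).obj W ∈ LL P 0 ∧ (FN S d (M + 1)).obj W ∉ LL P 0 := by
    by_contra hcon
    push Not at hcon
    apply hzero
    have hall : ∀ j : ℕ, (FN S d (j + m)).obj W ∈ LL P 0 := by
      intro j
      induction j with
      | zero => rw [Nat.zero_add]; exact hm
      | succ j ih => rw [Nat.succ_add]; exact hcon _ ih
    have hz : IsZero ((FN S d m).obj W) := by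
      apply hnd.inter_zero
      intro j
      rw [FN_obj, ← iterObj_add, ← FN_obj, mem_LL_zero_iff]
      exact hall j
    rw [IsZero.iff_id_eq_zero]
    apply (FN S d m).map_injective
    exact hz.eq_of_src _ _
  obtain ⟨A, hA, Y', hY', f, g, h, hT⟩ := hadj.decomp ((FN S d (M + 1)).obj W)
  rw [mem_LL_zero_iff] at hA
  let F := FN S d (M + 1)
  let WA := F.objPreimage A
  let eA : F.obj WA ≅ A := F.objObjPreimageIso A
  let WY := F.objPreimage Y'
  let eY : F.obj WY ≅ Y' := F.objObjPreimageIso Y'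
  have eZ : (nud S d).obj ((FN S d M).obj WY) ≅ Y' := eY
  obtain ⟨hZ, h0⟩ := trunc_step hP hd hadj (hW.FN (M + 1)) hA hY' eZ hT
  obtain ⟨s, ρ, hs, hρ, hsum⟩ := split_triangle hT h0
  let fW : WA ⟶ W := F.preimage (eA.hom ≫ f)
  let ρW : W ⟶ WA := F.preimage (ρ ≫ eA.inv)
  let gW : W ⟶ WY := F.preimage (g ≫ eY.inv)
  let sW : WY ⟶ W := F.preimage (eY.hom ≫ s)
  have hf' : F.map fW = eA.hom ≫ f := F.map_preimage _
  have hρ' : F.map ρW = ρ ≫ eA.inv := F.map_preimage _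
  have hg' : F.map gW = g ≫ eY.inv := F.map_preimage _
  have hs' : F.map sW = eY.hom ≫ s := F.map_preimage _
  have hρf : F.map (ρW ≫ fW) = ρ ≫ f := by
    rw [F.map_comp, hf', hρ', Category.assoc, Iso.inv_hom_id_assoc]
  have hgs : F.map (gW ≫ sW) = g ≫ s := by
    rw [F.map_comp, hg', hs', Category.assoc, Iso.inv_hom_id_assoc]
  let rA : Retract WA W := ⟨fW, ρW, F.map_injective (by
    rw [F.map_comp, hf', hρ', Category.assoc, ← Category.assoc f, hρ, Category.id_comp,
      Iso.hom_inv_id, F.map_id])⟩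
  let rY : Retract WY W := ⟨sW, gW, F.map_injective (by
    rw [F.map_comp, hg', hs', Category.assoc, ← Category.assoc s, hs, Category.id_comp,
      Iso.hom_inv_id, F.map_id])⟩
  have hsumW : ρW ≫ fW + gW ≫ sW = 𝟙 W := by
    apply F.map_injective
    rw [F.map_add, hρf, hgs, F.map_id]
    exact hsum
  have hne : rA.r ≫ rA.i ≠ 𝟙 W := by
    intro heq
    have heq' : ρW ≫ fW = 𝟙 W := heq
    rw [heq', F.map_id] at hρf
    exact hM' (LL.retract hA ⟨ρ, f, hρf.symm⟩)
  have hWA : WA ∈ addSet (OrbSet S d P) := by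
    refine IH _ ?_ WA rfl (hW.retract rA) (M + 1) (LL.retract hA (Retract.ofIso eA))
    rw [← hn]
    exact finrank_lt_of_retract rA hne
  have hWY : WY ∈ addSet (OrbSet S d P) := by
    obtain ⟨p, hp, ⟨r⟩⟩ := retract_of_GE_LE hP hZ (LL.retract hM (rY.map (FN S d M)))
    exact addSet_of_FN M (addSet.retract
      (sums.mono (fun _ hq => OrbSet.of_mem S d hq) hp).mem_addSet r)
  exact addSet.sum hWA hWY ρW fW gW sW hsumW

theorem statement_8 [∀ X Y : C, FiniteDimensional k (X ⟶ Y)] [IsIdempotentComplete C]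
    (S : SerreFunctor k C) (d : ℕ) (hd : 1 ≤ d)
    (P : Set C) (hsilt : IsSiltingSet P)
    (hdsilt : ∀ A ∈ P, ∀ B ∈ P, ∀ i j : ℕ, 1 ≤ i → 1 ≤ j →
      ∀ f : iterObj (nud S d) j A ⟶ B⟦(i : ℤ)⟧, f = 0)
    (hnd : NudNonDegenerate S d P)
    (B : Set C) (hadj : AdjacentTStructure P B) :
    ∀ X : C, X ∈ UdSet S d P ↔
      (∀ A ∈ UdSet S d P, ∀ i : ℤ, 1 ≤ i → i ≤ (d : ℤ) - 1 →
        ∀ f : A ⟶ X⟦i⟧, f = 0) := by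
  have hd' : DS S d P := hdsilt
  intro X
  change X ∈ addSet (OrbSet S d P) ↔ (∀ A ∈ addSet (OrbSet S d P), ∀ i : ℤ, 1 ≤ i →
    i ≤ (d : ℤ) - 1 → ∀ f : A ⟶ X⟦i⟧, f = 0)
  constructor
  · intro hX A hA i hi hi'
    exact rigid_add hsilt.1 hd' hA hX i hi hi'
  · intro h
    have hX : Perp S d P X := fun g hg i hi hi' => h g (sums.of hg).mem_addSet i hi hi'
    obtain ⟨n, hn⟩ := hnd.union_all X
    have hperp : ∀ j : ℕ, Perp S d P (iterObj (nudInv S d) j X) := by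
      intro j
      induction j with
      | zero => exact hX
      | succ j ih => exact ih.nudInv
    have hmem : iterObj (nudInv S d) n X ∈ addSet (OrbSet S d P) :=
      main_induction hsilt hd' hnd hadj _ _ rfl (hperp n) 0 ((mem_LL_zero_iff _ _).1 hn)
    have hiter : ∀ j : ℕ, iterObj (nud S d) j (iterObj (nudInv S d) n X) ∈
        addSet (OrbSet S d P) := by
      intro j
      induction j with
      | zero => exact hmem
      | succ j ih => exact addSet.map (nud S d) (fun _ => OrbSet.nud) ih
    obtain ⟨e⟩ := iter_nud_nudInv S d n X
    exact addSet.retract (hiter n) (Retract.ofIso e.symm)
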